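/- Let 0 < μ ≤ 1/2 and d ≥ 1. Define M_*(μ) := 12(4d/μ)², L_*(μ) := 2M_*(μ) = 24(4d)²μ^{-2}, κ(μ) := μ^d/(4^{2d+1} e^d d^d) · [1 + 2 ln(2)(d^{-1}+1) + ln(4d/μ)]^{-2d}, α_*(μ) := |S^{d-1}| μ^{(2+d)/2} / (2^{1+d/2}(2π)^d(4d)^5) with |S^{d-1}| = 2π^{d/2}/Γ(d/2), δ_*(μ) := min{α_*(μ)²/(12d)², α_*(μ)/(3μ[4M_*(μ)+1]^d), κ(μ)/2}, and U_*(μ) := max{2μ/δ_*(μ), 24d²/(α_*(μ)δ_*(μ))}. Then for every even integer L ≥ L_*(μ) and every U ≥ U_*(μ), the HFz ground-state energy satisfies E^{hfz}_{μ,U} = Tr{[-Δ - μ·Id]_-}. -/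

import Mathlib

open Matrix
open scoped BigOperators Classical ComplexOrder

noncomputable section

/-- The discrete torus `Λ = (ℤ/Lℤ)^d`. -/
abbrev Lam (d L : ℕ) : Type := Fin d → ZMod L

/-- `x` and `y` are nearest neighbors on the torus (ℓ¹-distance 1). -/
def isNN {d L : ℕ} (x y : Lam d L) : Prop :=
  ∃ ν : Fin d, (x ν = y ν + 1 ∨ x ν + 1 = y ν) ∧ ∀ μ : Fin d, μ ≠ ν → x μ = y μ

/-- The discrete Laplacian `Δ = T - 2d·Id` on the torus. -/
def lap (d L : ℕ) : Matrix (Lam d L) (Lam d L) ℂ :=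
  (Matrix.of fun x y => if isNN x y then (1 : ℂ) else 0) - (2 * (d : ℂ)) • 1

/-- A one-particle density matrix: hermitian with `0 ≤ γ ≤ 1` as quadratic forms. -/
def IsDM {d L : ℕ} [NeZero L] (γ : Matrix (Lam d L) (Lam d L) ℂ) : Prop :=
  γ.PosSemidef ∧ (1 - γ).PosSemidef

/-- `Tr{[X]_-}`: the sum of the negative eigenvalues of a hermitian matrix `X`
(junk value `0` if `X` is not hermitian). -/
def negTrace {n : Type} [Fintype n] [DecidableEq n] (X : Matrix n n ℂ) : ℝ :=
  if hX : X.IsHermitian then ∑ i, min (hX.eigenvalues i) 0 else 0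

/-- The HFz energy functional. -/
def hfzE {d L : ℕ} [NeZero L] (μ U : ℝ) (γu γd : Matrix (Lam d L) (Lam d L) ℂ) : ℝ :=
  (((-(lap d L) - (μ : ℂ) • 1) * (γu + γd)).trace).re
    + U * ∑ x, (γu x x).re * (γd x x).re

/-- The set of HFz energy values over pairs of one-particle density matrices. -/
def hfzEnergies (d L : ℕ) [NeZero L] (μ U : ℝ) : Set ℝ :=
  { E | ∃ γu γd : Matrix (Lam d L) (Lam d L) ℂ, IsDM γu ∧ IsDM γd ∧ hfzE μ U γu γd = E }

/-- `M_*(μ) := 12 (4d/μ)²`. -/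
def Mstar (d : ℕ) (μ : ℝ) : ℝ := 12 * (4 * d / μ) ^ 2

/-- `κ(μ) := μ^d/(4^{2d+1} e^d d^d) · [1 + 2 ln 2 (d⁻¹+1) + ln(4d/μ)]^{-2d}`. -/
def kappaConst (d : ℕ) (μ : ℝ) : ℝ :=
  μ ^ d / (4 ^ (2 * d + 1) * Real.exp 1 ^ d * (d : ℝ) ^ d *
    (1 + 2 * Real.log 2 * ((d : ℝ)⁻¹ + 1) + Real.log (4 * d / μ)) ^ (2 * d))

/-- `|S^{d-1}| = 2 π^{d/2} / Γ(d/2)`. -/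
def sphereMeasure (d : ℕ) : ℝ := 2 * Real.pi ^ ((d : ℝ) / 2) / Real.Gamma ((d : ℝ) / 2)

/-- `α_*(μ) := |S^{d-1}| μ^{(2+d)/2} / (2^{1+d/2} (2π)^d (4d)^5)`. -/
def alphaStar (d : ℕ) (μ : ℝ) : ℝ :=
  sphereMeasure d * μ ^ ((2 + (d : ℝ)) / 2) /
    (2 ^ (1 + (d : ℝ) / 2) * (2 * Real.pi) ^ d * (4 * (d : ℝ)) ^ 5)

/-- `δ_*(μ, α) := min{α²/(12d)², α/(3μ[4M_*(μ)+1]^d), κ(μ)/2}`. -/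
def deltaStar (d : ℕ) (μ α : ℝ) : ℝ :=
  min (α ^ 2 / (12 * (d : ℝ)) ^ 2)
    (min (α / (3 * μ * (4 * Mstar d μ + 1) ^ d)) (kappaConst d μ / 2))

/-- `U_*(μ, α) := max{2μ/δ_*(μ,α), 24d²/(α δ_*(μ,α))}`. -/
def Ustar (d : ℕ) (μ α : ℝ) : ℝ :=
  max (2 * μ / deltaStar d μ α) (24 * (d : ℝ) ^ 2 / (α * deltaStar d μ α))

section Spectral

variable {n : Type} [Fintype n] [DecidableEq n]

/-- The matrix of an orthonormal eigenbasis of a hermitian matrix, stored columnwise. -/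
def eigMat {X : Matrix n n ℂ} (hX : X.IsHermitian) : Matrix n n ℂ :=
  (hX.eigenvectorUnitary : Matrix n n ℂ)

lemma eigMat_star_mul {X : Matrix n n ℂ} (hX : X.IsHermitian) :
    (eigMat hX)ᴴ * eigMat hX = 1 := by
  have := Unitary.star_mul_self_of_mem hX.eigenvectorUnitary.2
  simpa [eigMat, Matrix.star_eq_conjTranspose] using this

lemma eigMat_mul_star {X : Matrix n n ℂ} (hX : X.IsHermitian) :
    eigMat hX * (eigMat hX)ᴴ = 1 := by
  have := Unitary.mul_star_self_of_mem hX.eigenvectorUnitary.2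
  simpa [eigMat, Matrix.star_eq_conjTranspose] using this

lemma eq_eigMat_mul_diagonal {X : Matrix n n ℂ} (hX : X.IsHermitian) :
    X = eigMat hX * diagonal (fun i => (hX.eigenvalues i : ℂ)) * (eigMat hX)ᴴ := by
  have := hX.spectral_theorem
  rw [Unitary.conjStarAlgAut_apply] at this
  exact this

/-- The projection onto the negative spectral subspace. -/
def negProj {X : Matrix n n ℂ} (hX : X.IsHermitian) : Matrix n n ℂ :=
  eigMat hX * diagonal (fun i => if hX.eigenvalues i < 0 then (1 : ℂ) else 0) * (eigMat hX)ᴴ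

lemma negProj_posSemidef {X : Matrix n n ℂ} (hX : X.IsHermitian) : (negProj hX).PosSemidef := by
  refine PosSemidef.mul_mul_conjTranspose_same (PosSemidef.diagonal ?_) _
  intro i
  dsimp only
  split_ifs <;> simp

lemma one_sub_negProj_posSemidef {X : Matrix n n ℂ} (hX : X.IsHermitian) :
    (1 - negProj hX).PosSemidef := by
  have h : 1 - negProj hX = eigMat hX *
      diagonal (fun i => if hX.eigenvalues i < 0 then (0 : ℂ) else 1) * (eigMat hX)ᴴ := by
    have h1 : diagonal (fun i => if hX.eigenvalues i < 0 then (0 : ℂ) else 1)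
        = 1 - diagonal (fun i => if hX.eigenvalues i < 0 then (1 : ℂ) else 0) := by
      rw [← diagonal_one, diagonal_sub]
      congr 1
      ext i
      split_ifs <;> simp
    rw [h1, mul_sub, sub_mul, mul_one, eigMat_mul_star, negProj]
  rw [h]
  refine PosSemidef.mul_mul_conjTranspose_same (PosSemidef.diagonal ?_) _
  intro i
  dsimp only
  split_ifs <;> simp

lemma trace_mul_eq_sum_eigenvalues {X : Matrix n n ℂ} (hX : X.IsHermitian) (γ : Matrix n n ℂ) :
    (X * γ).trace = ∑ i, (hX.eigenvalues i : ℂ) * ((eigMat hX)ᴴ * γ * eigMat hX) i i := by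
  conv_lhs => rw [eq_eigMat_mul_diagonal hX]
  rw [Matrix.mul_assoc, Matrix.mul_assoc, Matrix.trace_mul_comm, Matrix.mul_assoc, Matrix.trace]
  refine Finset.sum_congr rfl fun i _ => ?_
  rw [diag_apply, diagonal_mul]

lemma trace_mul_negProj {X : Matrix n n ℂ} (hX : X.IsHermitian) :
    ((X * negProj hX).trace).re = negTrace X := by
  rw [trace_mul_eq_sum_eigenvalues hX, negTrace, dif_pos hX, Complex.re_sum]
  refine Finset.sum_congr rfl fun i _ => ?_
  have : (eigMat hX)ᴴ * negProj hX * eigMat hX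
      = diagonal (fun i => if hX.eigenvalues i < 0 then (1 : ℂ) else 0) := by
    rw [negProj, ← Matrix.mul_assoc, ← Matrix.mul_assoc, eigMat_star_mul, one_mul,
      Matrix.mul_assoc, eigMat_star_mul, mul_one]
  rw [this, diagonal_apply_eq]
  split_ifs with h
  · simp [h.le]
  · simp [not_lt.mp h]

/-- The variational principle for `negTrace`. -/
lemma negTrace_le_trace {X γ : Matrix n n ℂ} (hX : X.IsHermitian) (h0 : γ.PosSemidef)
    (h1 : (1 - γ).PosSemidef) : negTrace X ≤ ((X * γ).trace).re := by
  rw [trace_mul_eq_sum_eigenvalues hX, negTrace, dif_pos hX, Complex.re_sum]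
  refine Finset.sum_le_sum fun i _ => ?_
  rw [Complex.re_ofReal_mul]
  have a0 : 0 ≤ (((eigMat hX)ᴴ * γ * eigMat hX) i i).re :=
    (Complex.le_def.mp (h0.conjTranspose_mul_mul_same (eigMat hX)).diag_nonneg).1
  have a1 : (((eigMat hX)ᴴ * γ * eigMat hX) i i).re ≤ 1 := by
    have := (Complex.le_def.mp ((h1.conjTranspose_mul_mul_same (eigMat hX)).diag_nonneg (i := i))).1
    rw [mul_sub, sub_mul, mul_one, eigMat_star_mul] at this
    simpa using this
  rcases le_total (hX.eigenvalues i) 0 with h | h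
  · rw [min_eq_left h]; nlinarith
  · rw [min_eq_right h]; positivity

/-- The coefficient of `v` along the `i`-th eigenvector. -/
def eigCoef {X : Matrix n n ℂ} (hX : X.IsHermitian) (v : n → ℂ) (i : n) : ℂ :=
  ((eigMat hX)ᴴ *ᵥ v) i

omit [DecidableEq n] in
lemma star_dotProduct_self_re (v : n → ℂ) : (star v ⬝ᵥ v).re = ∑ x, ‖v x‖ ^ 2 := by
  rw [dotProduct, Complex.re_sum]
  refine Finset.sum_congr rfl fun x _ => ?_
  rw [Pi.star_apply, Complex.star_def, Complex.conj_mul', ← Complex.ofReal_pow, Complex.ofReal_re]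

lemma sum_eigCoef_sq {X : Matrix n n ℂ} (hX : X.IsHermitian) (v : n → ℂ) :
    ∑ i, ‖eigCoef hX v i‖ ^ 2 = ∑ x, ‖v x‖ ^ 2 := by
  rw [← star_dotProduct_self_re v, ← star_dotProduct_self_re (eigCoef hX v)]
  congr 1
  change star ((eigMat hX)ᴴ *ᵥ v) ⬝ᵥ ((eigMat hX)ᴴ *ᵥ v) = _
  rw [star_mulVec, conjTranspose_conjTranspose, ← dotProduct_mulVec, mulVec_mulVec,
    eigMat_mul_star, one_mulVec]

lemma quadForm_eq_sum {X : Matrix n n ℂ} (hX : X.IsHermitian) (v : n → ℂ) :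
    (star v ⬝ᵥ X *ᵥ v).re = ∑ i, hX.eigenvalues i * ‖eigCoef hX v i‖ ^ 2 := by
  have h : star v ⬝ᵥ X *ᵥ v = star (eigCoef hX v) ⬝ᵥ
      diagonal (fun i => (hX.eigenvalues i : ℂ)) *ᵥ (eigCoef hX v) := by
    change _ = star ((eigMat hX)ᴴ *ᵥ v) ⬝ᵥ _ *ᵥ ((eigMat hX)ᴴ *ᵥ v)
    rw [star_mulVec, conjTranspose_conjTranspose, ← dotProduct_mulVec, mulVec_mulVec, mulVec_mulVec]
    rw [← eq_eigMat_mul_diagonal hX]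
  rw [h, dotProduct, Complex.re_sum]
  refine Finset.sum_congr rfl fun x _ => ?_
  rw [mulVec_diagonal, Pi.star_apply, Complex.star_def, mul_left_comm, Complex.conj_mul',
    ← Complex.ofReal_pow, ← Complex.ofReal_mul, Complex.ofReal_re]

lemma eigCoef_mulVec {X : Matrix n n ℂ} (hX : X.IsHermitian) (v : n → ℂ) (i : n) :
    eigCoef hX (X *ᵥ v) i = hX.eigenvalues i * eigCoef hX v i := by
  have h : (eigMat hX)ᴴ *ᵥ (X *ᵥ v) =
      diagonal (fun i => (hX.eigenvalues i : ℂ)) *ᵥ ((eigMat hX)ᴴ *ᵥ v) := by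
    have h' : (eigMat hX)ᴴ * X =
        diagonal (fun i => (hX.eigenvalues i : ℂ)) * (eigMat hX)ᴴ := by
      conv_lhs => enter [2]; rw [eq_eigMat_mul_diagonal hX]
      rw [← Matrix.mul_assoc, ← Matrix.mul_assoc, eigMat_star_mul, one_mul]
    rw [mulVec_mulVec, mulVec_mulVec, h']
  rw [eigCoef, h, mulVec_diagonal, eigCoef]

/-- The `i`-th eigenvector. -/
def eigVec {X : Matrix n n ℂ} (hX : X.IsHermitian) (i : n) : n → ℂ := fun x => eigMat hX x i

lemma star_eigVec_dotProduct {X : Matrix n n ℂ} (hX : X.IsHermitian) (v : n → ℂ) (i : n) :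
    star (eigVec hX i) ⬝ᵥ v = eigCoef hX v i := rfl

lemma eigCoef_eigVec {X : Matrix n n ℂ} (hX : X.IsHermitian) (i j : n) :
    eigCoef hX (eigVec hX i) j = if j = i then 1 else 0 := by
  have := congrFun (congrFun (eigMat_star_mul hX) j) i
  rw [one_apply] at this
  exact this

lemma sum_eigVec_sq {X : Matrix n n ℂ} (hX : X.IsHermitian) (i : n) :
    ∑ x, ‖eigVec hX i x‖ ^ 2 = 1 := by
  rw [← sum_eigCoef_sq hX, Finset.sum_eq_single i]
  · simp [eigCoef_eigVec]
  · intro j _ hj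
    simp [eigCoef_eigVec, hj]
  · simp

lemma quadForm_eigVec {X : Matrix n n ℂ} (hX : X.IsHermitian) (i : n) :
    (star (eigVec hX i) ⬝ᵥ X *ᵥ eigVec hX i).re = hX.eigenvalues i := by
  rw [quadForm_eq_sum hX, Finset.sum_eq_single i]
  · simp [eigCoef_eigVec]
  · intro j _ hj
    simp [eigCoef_eigVec, hj]
  · simp

end Spectral

section Torus

variable {d L : ℕ} [NeZero L]

/-- The hopping amplitude between two sites: `1` for nearest neighbors, `0` otherwise. -/
def nnW (x y : Lam d L) : ℝ := if isNN x y then 1 else 0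

omit [NeZero L] in
lemma isNN_comm (x y : Lam d L) : isNN x y ↔ isNN y x := by
  constructor <;>
  · rintro ⟨ν, h, h'⟩
    exact ⟨ν, h.symm.imp Eq.symm Eq.symm, fun i hi => (h' i hi).symm⟩

omit [NeZero L] in
lemma nnW_comm (x y : Lam d L) : nnW x y = nnW y x := by
  simp only [nnW, isNN_comm x y]

omit [NeZero L] in
lemma nnW_nonneg (x y : Lam d L) : 0 ≤ nnW x y := by
  rw [nnW]; split_ifs <;> norm_num

/-- The step in direction `p.1`, forward or backward according to `p.2`. -/
def unitStep (p : Fin d × Bool) : Lam d L := Pi.single p.1 (if p.2 then 1 else -1)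

omit [NeZero L] in
lemma unitStep_injective (hL : 3 ≤ L) : Function.Injective (unitStep (d := d) (L := L)) := by
  have h2 : (2 : ZMod L) ≠ 0 := by
    intro h
    have : ((2 : ℕ) : ZMod L) = 0 := by exact_mod_cast h
    rw [ZMod.natCast_eq_zero_iff] at this
    have := Nat.le_of_dvd (by norm_num) this
    omega
  have h1 : (1 : ZMod L) ≠ 0 := by
    intro h; apply h2; rw [← one_add_one_eq_two, h, add_zero]
  have h3 : (1 : ZMod L) ≠ -1 := by
    intro h; apply h2; rw [← one_add_one_eq_two]; nth_rewrite 1 [h]; ring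
  rintro ⟨ν, s⟩ ⟨ν', s'⟩ h
  have e := congrFun h ν
  simp only [unitStep, Pi.single_eq_same] at e
  by_cases hν : ν = ν'
  · subst hν
    rw [Pi.single_eq_same] at e
    cases s <;> cases s' <;> simp_all [eq_comm]
  · rw [Pi.single_eq_of_ne hν] at e
    cases s <;> simp_all

omit [NeZero L] in
lemma isNN_iff_exists_unitStep (x y : Lam d L) : isNN x y ↔ ∃ p, x + unitStep p = y := by
  constructor
  · rintro ⟨ν, h, h'⟩
    rcases h with h | h
    · refine ⟨(ν, false), funext fun i => ?_⟩
      by_cases hi : i = ν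
      · subst hi; simp [unitStep, h]
      · simp [unitStep, hi, h' i hi]
    · refine ⟨(ν, true), funext fun i => ?_⟩
      by_cases hi : i = ν
      · subst hi; simp [unitStep, h]
      · simp [unitStep, hi, h' i hi]
  · rintro ⟨⟨ν, s⟩, rfl⟩
    refine ⟨ν, ?_, fun i hi => by simp [unitStep, hi]⟩
    cases s <;> simp [unitStep]

lemma sum_nnW_mul (hL : 3 ≤ L) (x : Lam d L) (f : Lam d L → ℂ) :
    ∑ y, (nnW x y : ℂ) * f y = ∑ p : Fin d × Bool, f (x + unitStep p) := by
  have h : ∀ y, (nnW x y : ℂ) * f y = if isNN x y then f y else 0 := by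
    intro y; rw [nnW]; split_ifs <;> simp
  simp_rw [h]
  rw [← Finset.sum_filter]
  have h' : Finset.univ.filter (fun y => isNN x y)
      = Finset.univ.image (fun p : Fin d × Bool => x + unitStep p) := by
    ext y; simp [isNN_iff_exists_unitStep]
  rw [h', Finset.sum_image]
  intro p _ q _ hpq
  exact unitStep_injective hL (add_left_cancel hpq)

lemma sum_nnW (hL : 3 ≤ L) (x : Lam d L) : ∑ y, nnW x y = 2 * d := by
  have := sum_nnW_mul hL x (fun _ => 1)
  simp only [mul_one, Finset.sum_const, Finset.card_univ, Fintype.card_prod, Fintype.card_fin,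
    Fintype.card_bool, nsmul_eq_mul] at this
  have h2 : ((∑ y, nnW x y : ℝ) : ℂ) = ((2 * d : ℝ) : ℂ) := by
    push_cast; rw [this]; push_cast; ring
  exact_mod_cast h2

/-- The character of the torus with momentum `k`. -/
def chr (k x : Lam d L) : ℂ := ∏ ν, ZMod.stdAddChar (k ν * x ν)

/-- The dispersion relation of `-Δ`. -/
def disp (k : Lam d L) : ℝ := ∑ ν, (2 - 2 * (ZMod.stdAddChar (k ν) : ℂ).re)

lemma norm_stdAddChar (a : ZMod L) : ‖(ZMod.stdAddChar a : ℂ)‖ = 1 := by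
  exact Circle.norm_coe _

lemma stdAddChar_neg (a : ZMod L) :
    (ZMod.stdAddChar (-a) : ℂ) = (starRingEnd ℂ) (ZMod.stdAddChar a) := by
  rw [AddChar.map_neg_eq_conj]

lemma norm_chr (k x : Lam d L) : ‖chr k x‖ = 1 := by
  rw [chr, norm_prod]; exact Finset.prod_eq_one fun ν _ => norm_stdAddChar _

lemma chr_add (k x y : Lam d L) : chr k (x + y) = chr k x * chr k y := by
  simp only [chr, Pi.add_apply, mul_add, AddChar.map_add_eq_mul, Finset.prod_mul_distrib]

lemma chr_sub (k x y : Lam d L) : chr k (x - y) = chr k x * (starRingEnd ℂ) (chr k y) := by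
  rw [chr, chr, chr, map_prod, ← Finset.prod_mul_distrib]
  refine Finset.prod_congr rfl fun ν _ => ?_
  rw [Pi.sub_apply, mul_sub, sub_eq_add_neg, AddChar.map_add_eq_mul, stdAddChar_neg]

lemma chr_unitStep (k : Lam d L) (p : Fin d × Bool) :
    chr k (unitStep p) = ZMod.stdAddChar (if p.2 then k p.1 else -k p.1) := by
  rw [chr, Finset.prod_eq_single p.1]
  · simp [unitStep]
  · intro i _ hi
    simp [unitStep, hi]
  · simp

lemma re_chr_unitStep (k : Lam d L) (p : Fin d × Bool) :
    (chr k (unitStep p)).re = (ZMod.stdAddChar (k p.1) : ℂ).re := by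
  rw [chr_unitStep]
  split_ifs
  · rfl
  · rw [stdAddChar_neg, Complex.conj_re]

lemma sum_nnW_mul_chr (hL : 3 ≤ L) (k x : Lam d L) :
    ∑ y, (nnW x y : ℂ) * chr k y = ((2 * d - disp k : ℝ) : ℂ) * chr k x := by
  rw [sum_nnW_mul hL]
  simp_rw [chr_add, ← Finset.mul_sum]
  rw [mul_comm]
  congr 1
  simp_rw [chr_unitStep]
  rw [Fintype.sum_prod_type]
  simp only [Fintype.sum_bool, if_true, Bool.false_eq_true, if_false, stdAddChar_neg,
    Complex.add_conj, disp, Finset.sum_sub_distrib, Finset.sum_const, Finset.card_univ,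
    Fintype.card_fin, nsmul_eq_mul]
  push_cast
  ring

lemma sum_chr (x : Lam d L) : ∑ k, chr k x = if x = 0 then (L : ℂ) ^ d else 0 := by
  have h : ∑ k : Lam d L, chr k x = ∏ ν, ∑ a : ZMod L, (ZMod.stdAddChar (a * x ν) : ℂ) := by
    rw [Finset.prod_univ_sum, Fintype.piFinset_univ]
    rfl
  rw [h]
  simp_rw [AddChar.sum_mulShift _ (ZMod.isPrimitive_stdAddChar L), ZMod.card]
  split_ifs with hx
  · subst hx; simp
  · obtain ⟨ν, hν⟩ := Function.ne_iff.mp hx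
    exact Finset.prod_eq_zero (Finset.mem_univ ν) (by rw [if_neg (by exact hν), Nat.cast_zero])

/-- The (unnormalized) Fourier coefficient of `f`. -/
def four (f : Lam d L → ℂ) (k : Lam d L) : ℂ := star (chr k) ⬝ᵥ f

lemma sum_four_mul (f g : Lam d L → ℂ) :
    ∑ k, (starRingEnd ℂ) (four f k) * four g k = (L : ℂ) ^ d * (star f ⬝ᵥ g) := by
  simp only [four, dotProduct, map_sum, map_mul, Pi.star_apply, Complex.star_def,
    Complex.conj_conj]
  simp_rw [Finset.sum_mul_sum]
  rw [Finset.sum_comm, Finset.mul_sum]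
  refine Finset.sum_congr rfl fun x _ => ?_
  rw [Finset.sum_comm, Finset.sum_eq_single x]
  · have := sum_chr (d := d) (L := L) (x - x)
    rw [if_pos (sub_self x)] at this
    rw [← this, Finset.sum_mul]
    refine Finset.sum_congr rfl fun k _ => ?_
    rw [chr_sub]; ring
  · intro y _ hy
    have := sum_chr (d := d) (L := L) (x - y)
    rw [if_neg (sub_ne_zero.mpr hy.symm)] at this
    rw [← mul_zero ((starRingEnd ℂ) (f x) * g y), ← this, Finset.mul_sum]
    refine Finset.sum_congr rfl fun k _ => ?_
    rw [chr_sub]; ring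
  · simp

lemma sum_four_sq (f : Lam d L → ℂ) :
    ∑ k, ‖four f k‖ ^ 2 = (L : ℝ) ^ d * ∑ x, ‖f x‖ ^ 2 := by
  have := congrArg Complex.re (sum_four_mul f f)
  rw [← star_dotProduct_self_re f]
  simp only [Complex.conj_mul', ← Complex.ofReal_pow, ← Complex.ofReal_natCast,
    Complex.re_ofReal_mul, ← Complex.ofReal_sum, Complex.ofReal_re] at this
  exact this

lemma three_quarters_le_re_chr (k x y : Lam d L) (hk : disp k < 1 / 2) (h : isNN x y) :
    3 / 4 ≤ ((starRingEnd ℂ) (chr k x) * chr k y).re := by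
  obtain ⟨p, rfl⟩ := (isNN_iff_exists_unitStep x y).mp h
  have e : (starRingEnd ℂ) (chr k x) * chr k (x + unitStep p) = chr k (unitStep p) := by
    rw [chr_add, ← mul_assoc, Complex.conj_mul', norm_chr]; simp
  rw [e, re_chr_unitStep]
  have h1 : 2 - 2 * (ZMod.stdAddChar (k p.1) : ℂ).re ≤ disp k := by
    rw [disp]
    refine Finset.single_le_sum (f := fun ν => 2 - 2 * (ZMod.stdAddChar (k ν) : ℂ).re)
      (fun ν _ => ?_) (Finset.mem_univ p.1)
    have := (Complex.re_le_norm (ZMod.stdAddChar (k ν) : ℂ)).trans_eq (norm_stdAddChar _)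
    linarith
  linarith

end Torus

section Hopping

variable {d L : ℕ} [NeZero L]

/-- The one-particle Hamiltonian `-Δ - μ`. -/
def hop (d L : ℕ) (μ : ℝ) : Matrix (Lam d L) (Lam d L) ℂ := -(lap d L) - (μ : ℂ) • 1

/-- The real matrix entries of `-Δ - μ`. -/
def hopEntry (μ : ℝ) (x y : Lam d L) : ℝ := (if x = y then 2 * d - μ else 0) - nnW x y

omit [NeZero L] in
lemma hop_apply (μ : ℝ) (x y : Lam d L) : hop d L μ x y = (hopEntry μ x y : ℂ) := by
  simp only [hop, lap, hopEntry, nnW, Matrix.sub_apply, Matrix.neg_apply, Matrix.smul_apply,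
    of_apply, one_apply, smul_eq_mul]
  split_ifs <;> push_cast <;> ring

omit [NeZero L] in
lemma hopEntry_comm (μ : ℝ) (x y : Lam d L) : hopEntry μ x y = hopEntry μ y x := by
  simp only [hopEntry, nnW_comm x y, eq_comm]

omit [NeZero L] in
lemma hop_isHermitian (μ : ℝ) : (hop d L μ).IsHermitian := by
  ext x y
  rw [conjTranspose_apply, hop_apply, hop_apply, hopEntry_comm, Complex.star_def,
    Complex.conj_ofReal]

lemma hop_mulVec (μ : ℝ) (v : Lam d L → ℂ) (x : Lam d L) :
    (hop d L μ *ᵥ v) x = (2 * d - μ : ℝ) * v x - ∑ y, (nnW x y : ℂ) * v y := by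
  simp only [mulVec, dotProduct, hop_apply, hopEntry, Complex.ofReal_sub, sub_mul,
    Finset.sum_sub_distrib]
  congr 1
  rw [Finset.sum_eq_single x]
  · rw [if_pos rfl]
    push_cast
    ring
  · intro y _ hy
    simp [hy.symm]
  · simp

lemma hop_mulVec_chr (hL : 3 ≤ L) (μ : ℝ) (k : Lam d L) :
    hop d L μ *ᵥ chr k = ((disp k - μ : ℝ) : ℂ) • chr k := by
  ext x
  rw [hop_mulVec, sum_nnW_mul_chr hL, Pi.smul_apply, smul_eq_mul]
  push_cast
  ring

lemma four_hop_mulVec (hL : 3 ≤ L) (μ : ℝ) (v : Lam d L → ℂ) (k : Lam d L) :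
    four (hop d L μ *ᵥ v) k = ((disp k - μ : ℝ) : ℂ) * four v k := by
  rw [four, dotProduct_mulVec, ← (hop_isHermitian μ).eq, ← star_mulVec,
    hop_mulVec_chr hL, star_smul, smul_dotProduct, four, Complex.star_def, Complex.conj_ofReal,
    smul_eq_mul]

lemma quadForm_hop_eq_sum_four (hL : 3 ≤ L) (μ : ℝ) (v : Lam d L → ℂ) :
    (L : ℝ) ^ d * (star v ⬝ᵥ hop d L μ *ᵥ v).re = ∑ k, (disp k - μ) * ‖four v k‖ ^ 2 := by
  have := congrArg Complex.re (sum_four_mul v (hop d L μ *ᵥ v))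
  simp only [four_hop_mulVec hL, mul_left_comm, Complex.conj_mul', ← Complex.ofReal_pow,
    ← Complex.ofReal_natCast, Complex.re_ofReal_mul, ← Complex.ofReal_mul,
    ← Complex.ofReal_sum, Complex.ofReal_re] at this
  exact this.symm

lemma sum_nnW_mul_left (hL : 3 ≤ L) (f : Lam d L → ℝ) :
    ∑ x, ∑ y, nnW x y * f x = 2 * d * ∑ x, f x := by
  simp_rw [← Finset.sum_mul, sum_nnW hL, Finset.mul_sum]

lemma sum_nnW_mul_right (hL : 3 ≤ L) (f : Lam d L → ℝ) :
    ∑ x, ∑ y, nnW x y * f y = 2 * d * ∑ x, f x := by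
  rw [Finset.sum_comm, ← sum_nnW_mul_left hL]
  simp_rw [nnW_comm]

lemma quadForm_hop_eq_sum_diff (hL : 3 ≤ L) (μ : ℝ) (v : Lam d L → ℂ) :
    (star v ⬝ᵥ hop d L μ *ᵥ v).re
      = (∑ x, ∑ y, nnW x y * ‖v x - v y‖ ^ 2) / 2 - μ * ∑ x, ‖v x‖ ^ 2 := by
  have h1 : (star v ⬝ᵥ hop d L μ *ᵥ v).re = (2 * d - μ) * ∑ x, ‖v x‖ ^ 2
      - ∑ x, ∑ y, nnW x y * ((starRingEnd ℂ) (v x) * v y).re := by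
    rw [dotProduct, Complex.re_sum, Finset.mul_sum, ← Finset.sum_sub_distrib]
    refine Finset.sum_congr rfl fun x _ => ?_
    rw [hop_mulVec, Pi.star_apply, Complex.star_def, mul_sub, mul_left_comm, Complex.conj_mul',
      Complex.sub_re, Complex.re_ofReal_mul, ← Complex.ofReal_pow, Complex.ofReal_re,
      Finset.mul_sum, Complex.re_sum]
    congr 1
    refine Finset.sum_congr rfl fun y _ => ?_
    rw [mul_left_comm, Complex.re_ofReal_mul]
  have h2 : ∀ x y, nnW x y * ‖v x - v y‖ ^ 2 = nnW x y * ‖v x‖ ^ 2 + nnW x y * ‖v y‖ ^ 2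
      - 2 * (nnW x y * ((starRingEnd ℂ) (v x) * v y).re) := by
    intro x y
    rw [← Complex.normSq_eq_norm_sq, ← Complex.normSq_eq_norm_sq, ← Complex.normSq_eq_norm_sq,
      Complex.normSq_sub]
    have : (v x * (starRingEnd ℂ) (v y)).re = ((starRingEnd ℂ) (v x) * v y).re := by
      simp
    rw [this]; ring
  simp_rw [h2, Finset.sum_sub_distrib, Finset.sum_add_distrib,
    sum_nnW_mul_left hL (fun x => ‖v x‖ ^ 2),
    sum_nnW_mul_right hL (fun x => ‖v x‖ ^ 2), ← Finset.mul_sum]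
  rw [h1]; ring

lemma quadForm_hop_le (hL : 3 ≤ L) (μ : ℝ) (v : Lam d L → ℂ) :
    (star v ⬝ᵥ hop d L μ *ᵥ v).re ≤ (4 * d - μ) * ∑ x, ‖v x‖ ^ 2 := by
  rw [quadForm_hop_eq_sum_diff hL]
  have h : ∑ x, ∑ y, nnW x y * ‖v x - v y‖ ^ 2
      ≤ ∑ x, ∑ y, (nnW x y * (2 * ‖v x‖ ^ 2) + nnW x y * (2 * ‖v y‖ ^ 2)) := by
    refine Finset.sum_le_sum fun x _ => Finset.sum_le_sum fun y _ => ?_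
    rw [← mul_add]
    refine mul_le_mul_of_nonneg_left ?_ (nnW_nonneg x y)
    have := norm_sub_le (v x) (v y)
    nlinarith [sq_nonneg (‖v x‖ - ‖v y‖), norm_nonneg (v x - v y)]
  simp_rw [Finset.sum_add_distrib, sum_nnW_mul_left hL (fun x => 2 * ‖v x‖ ^ 2),
    sum_nnW_mul_right hL (fun x => 2 * ‖v x‖ ^ 2), ← Finset.mul_sum] at h
  linarith

/-- The restriction of a function to the region `A`. -/
def res (A : Lam d L → Prop) (v : Lam d L → ℂ) (x : Lam d L) : ℂ := if A x then v x else 0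

/-- The Hamiltonian `-Δ - μ` restricted to the region `A`. -/
def hopOn (A : Lam d L → Prop) (μ : ℝ) : Matrix (Lam d L) (Lam d L) ℂ :=
  Matrix.of fun x y => if A x ∧ A y then hop d L μ x y else 0

omit [NeZero L] in
lemma hopOn_isHermitian (A : Lam d L → Prop) (μ : ℝ) : (hopOn A μ).IsHermitian := by
  ext x y
  rw [conjTranspose_apply, hopOn, of_apply, of_apply, apply_ite star,
    (hop_isHermitian μ).apply x y, star_zero]
  simp only [and_comm]

lemma hopOn_mulVec (A : Lam d L → Prop) (μ : ℝ) (v : Lam d L → ℂ) :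
    hopOn A μ *ᵥ v = res A (hop d L μ *ᵥ res A v) := by
  ext x
  simp only [mulVec, dotProduct, hopOn, of_apply, res]
  by_cases hx : A x
  · simp [hx]
  · simp [hx]

lemma res_dotProduct (A : Lam d L → Prop) (v w : Lam d L → ℂ) :
    star v ⬝ᵥ res A w = star (res A v) ⬝ᵥ w := by
  simp only [dotProduct, res, Pi.star_apply]
  refine Finset.sum_congr rfl fun x _ => ?_
  split_ifs <;> simp

lemma quadForm_hopOn (A : Lam d L → Prop) (μ : ℝ) (v : Lam d L → ℂ) :
    star v ⬝ᵥ hopOn A μ *ᵥ v = star (res A v) ⬝ᵥ hop d L μ *ᵥ res A v := by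
  rw [hopOn_mulVec, res_dotProduct]

/-- The sites of `A` having a neighbor outside `A`. -/
def bdry (A : Lam d L → Prop) : Finset (Lam d L) :=
  Finset.univ.filter fun x => A x ∧ ∃ y, isNN x y ∧ ¬ A y

/-- The source term produced by cutting a plane wave at the boundary of `A`. -/
def cutSource (A : Lam d L → Prop) (k x : Lam d L) : ℂ :=
  if A x then ∑ y, (nnW x y : ℂ) * (if A y then 0 else chr k y) else 0

lemma hopOn_mulVec_res_chr (hL : 3 ≤ L) (A : Lam d L → Prop) (μ : ℝ) (k : Lam d L) :
    hopOn A μ *ᵥ res A (chr k) = ((disp k - μ : ℝ) : ℂ) • res A (chr k) + cutSource A k := by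
  ext x
  have hres : res A (res A (chr k)) = res A (chr k) := by
    ext y; simp only [res]; split_ifs <;> rfl
  rw [hopOn_mulVec, hres, Pi.add_apply, Pi.smul_apply]
  by_cases hx : A x
  · simp only [res, cutSource, hx, if_true]
    have h := congrFun (hop_mulVec_chr hL μ k) x
    rw [hop_mulVec, Pi.smul_apply] at h
    rw [hop_mulVec, ← h]
    have hx' : res A (chr k) x = chr k x := if_pos hx
    rw [sub_add, hx', sub_right_inj, ← Finset.sum_sub_distrib]
    refine Finset.sum_congr rfl fun y _ => ?_
    rw [res]
    split_ifs <;> simp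
  · simp [res, cutSource, hx]

lemma cutSource_eq_zero (A : Lam d L → Prop) (k x : Lam d L) (hx : x ∉ bdry A) :
    cutSource A k x = 0 := by
  rw [cutSource]
  split_ifs with h
  · refine Finset.sum_eq_zero fun y _ => ?_
    split_ifs with hy
    · simp
    · have : ¬ isNN x y := fun hn =>
        hx (Finset.mem_filter.mpr ⟨Finset.mem_univ _, h, y, hn, hy⟩)
      simp [nnW, this]
  · rfl

lemma three_quarters_le_norm_cutSource (A : Lam d L → Prop) (k x : Lam d L)
    (hk : disp k < 1 / 2) (hx : x ∈ bdry A) : 3 / 4 ≤ ‖cutSource A k x‖ := by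
  simp only [bdry, Finset.mem_filter] at hx
  obtain ⟨-, hA, z, hz, hzA⟩ := hx
  have h1 : ((starRingEnd ℂ) (chr k x) * cutSource A k x).re ≤ ‖cutSource A k x‖ := by
    refine (Complex.re_le_norm _).trans_eq ?_
    rw [norm_mul, RCLike.norm_conj, norm_chr, one_mul]
  refine le_trans ?_ h1
  rw [cutSource, if_pos hA, Finset.mul_sum, Complex.re_sum]
  have h2 : ∀ y, 0 ≤ ((starRingEnd ℂ) (chr k x) *
      ((nnW x y : ℂ) * (if A y then 0 else chr k y))).re := by
    intro y
    split_ifs with hy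
    · simp
    · rw [mul_left_comm, Complex.re_ofReal_mul]
      by_cases hn : isNN x y
      · have := three_quarters_le_re_chr k x y hk hn
        exact mul_nonneg (nnW_nonneg x y) (by linarith)
      · simp [nnW, hn]
  refine le_trans ?_ (Finset.single_le_sum (fun y _ => h2 y) (Finset.mem_univ z))
  rw [if_neg hzA, mul_left_comm, Complex.re_ofReal_mul, nnW, if_pos hz, one_mul]
  exact three_quarters_le_re_chr k x z hk hz

lemma sum_le_quadForm_of_bdry (hL : 3 ≤ L) (A : Lam d L → Prop) {μ : ℝ} (b : Lam d L → ℂ)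
    (hb : ∀ x, x ∉ bdry A → b x = 0) :
    (1 - μ) * ∑ x, ‖b x‖ ^ 2 ≤ (star b ⬝ᵥ hopOn A μ *ᵥ b).re := by
  have hA : ∀ x, ¬ A x → b x = 0 := fun x hx => hb x (by simp [bdry, hx])
  have hres : res A b = b := by
    ext x
    simp only [res]
    split_ifs with h
    · rfl
    · exact (hA x h).symm
  rw [quadForm_hopOn, hres, quadForm_hop_eq_sum_diff hL]
  have h1 : ∑ x, ‖b x‖ ^ 2 ≤ ∑ x, ∑ y, nnW x y * (if A x ∧ ¬ A y then ‖b x‖ ^ 2 else 0) := by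
    refine Finset.sum_le_sum fun x _ => ?_
    have h0 : ∀ y, 0 ≤ nnW x y * (if A x ∧ ¬ A y then ‖b x‖ ^ 2 else 0) := fun y =>
      mul_nonneg (nnW_nonneg x y) (by split_ifs <;> positivity)
    by_cases hx : x ∈ bdry A
    · simp only [bdry, Finset.mem_filter] at hx
      obtain ⟨-, hAx, z, hz, hzA⟩ := hx
      refine le_trans ?_ (Finset.single_le_sum (fun y _ => h0 y) (Finset.mem_univ z))
      rw [if_pos ⟨hAx, hzA⟩, nnW, if_pos hz, one_mul]
    · rw [hb x hx, norm_zero, zero_pow two_ne_zero]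
      simp
  have h2 : ∑ x, ∑ y, nnW x y * (if A y ∧ ¬ A x then ‖b y‖ ^ 2 else 0)
      = ∑ x, ∑ y, nnW x y * (if A x ∧ ¬ A y then ‖b x‖ ^ 2 else 0) := by
    rw [Finset.sum_comm]
    exact Finset.sum_congr rfl fun y _ => Finset.sum_congr rfl fun x _ => by rw [nnW_comm]
  have h3 : ∑ x, ∑ y, nnW x y * (if A x ∧ ¬ A y then ‖b x‖ ^ 2 else 0)
      + ∑ x, ∑ y, nnW x y * (if A y ∧ ¬ A x then ‖b y‖ ^ 2 else 0)
      ≤ ∑ x, ∑ y, nnW x y * ‖b x - b y‖ ^ 2 := by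
    simp_rw [← Finset.sum_add_distrib]
    refine Finset.sum_le_sum fun x _ => Finset.sum_le_sum fun y _ => ?_
    rw [← mul_add]
    refine mul_le_mul_of_nonneg_left ?_ (nnW_nonneg x y)
    by_cases hx : A x <;> by_cases hy : A y
    · simp [hx, hy]
    · simp [hx, hy, hA y hy]
    · simp [hx, hy, hA x hx]
    · simp [hx, hy]
  linarith

end Hopping

section Boundary

variable {d L : ℕ} [NeZero L]

/-- The depth of the momentum `k` below the chemical potential. -/
def depth (μ : ℝ) (k : Lam d L) : ℝ := max (μ - disp k) 0

/-- Minus the energy of the filled Fermi sea. -/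
def seaDepth (d L : ℕ) [NeZero L] (μ : ℝ) : ℝ := ∑ k : Lam d L, depth μ k

lemma disp_nonneg (k : Lam d L) : 0 ≤ disp k := by
  refine Finset.sum_nonneg fun ν _ => ?_
  have := (Complex.re_le_norm (ZMod.stdAddChar (k ν) : ℂ)).trans_eq (norm_stdAddChar _)
  linarith

lemma sum_norm_res_chr_sq (A : Lam d L → Prop) (k : Lam d L) :
    ∑ x, ‖res A (chr k) x‖ ^ 2 = (Finset.univ.filter A).card := by
  rw [Finset.card_filter, Nat.cast_sum]
  refine Finset.sum_congr rfl fun x _ => ?_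
  rw [res]
  split_ifs <;> simp [norm_chr]

lemma eigenvalues_hopOn_eq (hL : 3 ≤ L) (A : Lam d L → Prop) (μ : ℝ)
    (hX : (hopOn A μ).IsHermitian) (i : Lam d L) :
    (L : ℝ) ^ d * hX.eigenvalues i
      = ∑ k, (disp k - μ) * ‖eigCoef hX (res A (chr k)) i‖ ^ 2 := by
  rw [← quadForm_eigVec hX i, quadForm_hopOn, quadForm_hop_eq_sum_four hL]
  refine Finset.sum_congr rfl fun k _ => ?_
  congr 2
  rw [four, ← star_eigVec_dotProduct, res_dotProduct, ← norm_star, star_dotProduct, star_star]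

lemma eigenvalues_hopOn_le (hL : 3 ≤ L) (A : Lam d L → Prop) {μ : ℝ} (hμ : μ ≤ 4 * d)
    (hX : (hopOn A μ).IsHermitian) (i : Lam d L) : hX.eigenvalues i ≤ 4 * d - μ := by
  rw [← quadForm_eigVec hX i, quadForm_hopOn]
  refine (quadForm_hop_le hL μ _).trans ?_
  have : ∑ x, ‖res A (eigVec hX i) x‖ ^ 2 ≤ 1 := by
    rw [← sum_eigVec_sq hX i]
    refine Finset.sum_le_sum fun x _ => ?_
    rw [res]
    split_ifs
    · rfl
    · rw [norm_zero, zero_pow two_ne_zero]; positivity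
  nlinarith

lemma bdry_card_le_sum_eigCoef (hL : 3 ≤ L) (hd : 1 ≤ d) (A : Lam d L → Prop) {μ : ℝ}
    (hμ0 : 0 ≤ μ) (hμ : μ ≤ 1 / 2) (hX : (hopOn A μ).IsHermitian) (k : Lam d L)
    (hk : disp k < μ) :
    9 / (2048 * (d : ℝ) ^ 3) * (bdry A).card ≤
      ∑ i, if 0 ≤ hX.eigenvalues i then ‖eigCoef hX (res A (chr k)) i‖ ^ 2 else 0 := by
  have hd' : (1 : ℝ) ≤ d := by exact_mod_cast hd
  set b := cutSource A k
  have hb : ∀ i, eigCoef hX b i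
      = ((hX.eigenvalues i - (disp k - μ) : ℝ) : ℂ) * eigCoef hX (res A (chr k)) i := by
    intro i
    have h := congrArg (fun v => eigCoef hX v i) (hopOn_mulVec_res_chr hL A μ k)
    simp only [eigCoef_mulVec] at h
    have h2 : eigCoef hX (((disp k - μ : ℝ) : ℂ) • res A (chr k) + b) i
        = ((disp k - μ : ℝ) : ℂ) * eigCoef hX (res A (chr k)) i + eigCoef hX b i := by
      rw [eigCoef, mulVec_add, mulVec_smul]; rfl
    rw [h2] at h
    push_cast at h ⊢
    linear_combination -h
  have h1 : 9 / 16 * ((bdry A).card : ℝ) ≤ ∑ x, ‖b x‖ ^ 2 := by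
    have : ∑ x ∈ bdry A, ‖b x‖ ^ 2 ≤ ∑ x, ‖b x‖ ^ 2 :=
      Finset.sum_le_univ_sum_of_nonneg fun x => by positivity
    refine le_trans ?_ this
    rw [mul_comm, ← nsmul_eq_mul]
    refine Finset.card_nsmul_le_sum _ _ _ fun x hx => ?_
    have := three_quarters_le_norm_cutSource A k x (hk.trans_le hμ) hx
    change 3 / 4 ≤ ‖b x‖ at this
    nlinarith
  have h2 : (1 - μ) * ∑ x, ‖b x‖ ^ 2 ≤ (star b ⬝ᵥ hopOn A μ *ᵥ b).re :=
    sum_le_quadForm_of_bdry hL A b fun x hx => cutSource_eq_zero A k x hx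
  rw [quadForm_eq_sum hX] at h2
  have h3 : ∑ i, hX.eigenvalues i * ‖eigCoef hX b i‖ ^ 2 ≤ 64 * (d : ℝ) ^ 3 *
      ∑ i, if 0 ≤ hX.eigenvalues i then ‖eigCoef hX (res A (chr k)) i‖ ^ 2 else 0 := by
    rw [Finset.mul_sum]
    refine Finset.sum_le_sum fun i _ => ?_
    split_ifs with hi
    · rw [hb, norm_mul, Complex.norm_real, mul_pow, Real.norm_eq_abs, sq_abs, ← mul_assoc]
      refine mul_le_mul_of_nonneg_right ?_ (by positivity)
      have l1 := eigenvalues_hopOn_le hL A (by linarith) hX i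
      have l2 : hX.eigenvalues i - (disp k - μ) ≤ 4 * d := by linarith [disp_nonneg k]
      have l4 : hX.eigenvalues i ≤ 4 * d := by linarith
      have l3 : 0 ≤ hX.eigenvalues i - (disp k - μ) := by linarith
      calc hX.eigenvalues i * (hX.eigenvalues i - (disp k - μ)) ^ 2
          ≤ (4 * d) * (4 * d) ^ 2 := by gcongr
        _ = 64 * (d : ℝ) ^ 3 := by ring
    · rw [mul_zero]
      exact mul_nonpos_of_nonpos_of_nonneg (not_le.mp hi).le (by positivity)
  have h4 : 9 / 32 * ((bdry A).card : ℝ) ≤ (1 - μ) * ∑ x, ‖b x‖ ^ 2 := by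
    have : (0 : ℝ) ≤ (bdry A).card := by positivity
    nlinarith
  have h5 := h4.trans (h2.trans h3)
  rw [div_mul_eq_mul_div, div_le_iff₀ (by positivity)]
  linarith

/-- Cutting a region `A` out of the torus raises the ground-state energy per volume by an amount
proportional to the size of the boundary of `A`. -/
lemma le_negTrace_hopOn (hL : 3 ≤ L) (hd : 1 ≤ d) (A : Lam d L → Prop) {μ : ℝ}
    (hμ0 : 0 ≤ μ) (hμ : μ ≤ 1 / 2) :
    seaDepth d L μ * (9 / (2048 * (d : ℝ) ^ 3) * (bdry A).card - (Finset.univ.filter A).card)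
      ≤ (L : ℝ) ^ d * negTrace (hopOn A μ) := by
  have hX := hopOn_isHermitian A μ
  rw [negTrace, dif_pos hX, Finset.mul_sum, seaDepth, Finset.sum_mul]
  have h1 : ∀ i, ∑ k, -depth μ k *
      (if 0 ≤ hX.eigenvalues i then 0 else ‖eigCoef hX (res A (chr k)) i‖ ^ 2)
      ≤ (L : ℝ) ^ d * min (hX.eigenvalues i) 0 := by
    intro i
    by_cases hi : 0 ≤ hX.eigenvalues i
    · simp [hi]
    · rw [min_eq_left (not_le.mp hi).le, eigenvalues_hopOn_eq hL]
      simp only [hi, if_false]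
      refine Finset.sum_le_sum fun k _ => ?_
      refine mul_le_mul_of_nonneg_right ?_ (by positivity)
      have := le_max_left (μ - disp k) 0
      rw [depth]; linarith
  refine le_trans ?_ (Finset.sum_le_sum fun i _ => h1 i)
  rw [Finset.sum_comm]
  refine Finset.sum_le_sum fun k _ => ?_
  rw [← Finset.mul_sum]
  rcases le_or_gt μ (disp k) with hk | hk
  · simp [depth, hk]
  · have h2 := bdry_card_le_sum_eigCoef hL hd A hμ0 hμ hX k hk
    have h3 : (∑ i, if 0 ≤ hX.eigenvalues i then ‖eigCoef hX (res A (chr k)) i‖ ^ 2 else 0)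
        + (∑ i, if 0 ≤ hX.eigenvalues i then 0 else ‖eigCoef hX (res A (chr k)) i‖ ^ 2)
        = (Finset.univ.filter A).card := by
      rw [← sum_norm_res_chr_sq A k, ← sum_eigCoef_sq hX, ← Finset.sum_add_distrib]
      refine Finset.sum_congr rfl fun i _ => ?_
      split_ifs <;> simp
    have h4 : 0 ≤ depth μ k := le_max_right _ _
    nlinarith

lemma sum_eigCoef_chr_sq {X : Matrix (Lam d L) (Lam d L) ℂ} (hX : X.IsHermitian) (i : Lam d L) :
    ∑ k, ‖eigCoef hX (chr k) i‖ ^ 2 = (L : ℝ) ^ d := by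
  have h := sum_four_sq (eigVec hX i)
  rw [sum_eigVec_sq, mul_one] at h
  rw [← h]
  refine Finset.sum_congr rfl fun k _ => ?_
  rw [four, ← star_eigVec_dotProduct, ← norm_star, star_dotProduct, star_star]

lemma negTrace_hop_le (hL : 3 ≤ L) (μ : ℝ) : negTrace (hop d L μ) ≤ -seaDepth d L μ := by
  have hX := hop_isHermitian (d := d) (L := L) μ
  have hN : (0 : ℝ) < (L : ℝ) ^ d := by
    have : 0 < L := by omega
    positivity
  rw [negTrace, dif_pos hX]
  have h1 : ∀ k : Lam d L, ∑ i, min (hX.eigenvalues i) 0 * ‖eigCoef hX (chr k) i‖ ^ 2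
      ≤ (L : ℝ) ^ d * -depth μ k := by
    intro k
    have hq : (star (chr k) ⬝ᵥ hop d L μ *ᵥ chr k).re = (L : ℝ) ^ d * (disp k - μ) := by
      rw [hop_mulVec_chr hL, dotProduct_smul, smul_eq_mul, Complex.re_ofReal_mul,
        star_dotProduct_self_re]
      simp [norm_chr, ZMod.card, mul_comm]
    rw [quadForm_eq_sum hX] at hq
    rcases le_total (μ - disp k) 0 with h | h
    · rw [depth, max_eq_right h, neg_zero, mul_zero]
      exact Finset.sum_nonpos fun i _ =>
        mul_nonpos_of_nonpos_of_nonneg (min_le_right _ _) (by positivity)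
    · rw [depth, max_eq_left h, neg_sub, ← hq]
      exact Finset.sum_le_sum fun i _ =>
        mul_le_mul_of_nonneg_right (min_le_left _ _) (by positivity)
  have h2 := Finset.sum_le_sum fun k (_ : k ∈ Finset.univ) => h1 k
  rw [Finset.sum_comm] at h2
  simp_rw [← Finset.mul_sum, sum_eigCoef_chr_sq, Finset.sum_neg_distrib] at h2
  rw [← Finset.sum_mul, mul_comm] at h2
  exact le_of_mul_le_mul_left h2 hN

end Boundary

section Spins

variable {d L : ℕ} [NeZero L]

lemma re_le_sqrt_mul_sqrt {n : Type} [Fintype n] [DecidableEq n] {γ : Matrix n n ℂ}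
    (h : γ.PosSemidef) (x y : n) : (γ y x).re ≤ √(γ x x).re * √(γ y y).re := by
  have hx : 0 ≤ (γ x x).re := (Complex.le_def.mp h.diag_nonneg).1
  have hsymm : (γ x y).re = (γ y x).re := by
    rw [← h.1.apply x y, Complex.star_def, Complex.conj_re]
  have key : ∀ t : ℝ, 0 ≤ (γ x x).re * (t * t) + (-2 * (γ y x).re) * t + (γ y y).re := by
    intro t
    have h1 := (Complex.le_def.mp (h.dotProduct_mulVec_nonneg
      ((t : ℂ) • Pi.single x 1 - Pi.single y 1))).1
    have e : star ((t : ℂ) • (Pi.single x 1 : n → ℂ) - Pi.single y 1)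
        = (t : ℂ) • Pi.single x 1 - Pi.single y 1 := by
      have e1 : ∀ i : n, star (Pi.single i 1 : n → ℂ) = Pi.single i 1 := fun i => by
        rw [Pi.star_single, star_one]
      rw [star_sub, star_smul, e1, e1, Complex.star_def, Complex.conj_ofReal]
    rw [e] at h1
    simp only [mulVec_sub, mulVec_smul, mulVec_single_one, dotProduct_sub, sub_dotProduct,
      smul_dotProduct, dotProduct_smul, single_one_dotProduct, smul_eq_mul, Complex.sub_re,
      Complex.re_ofReal_mul, Complex.zero_re, col_apply, hsymm] at h1
    linarith
  have := discrim_le_zero key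
  rw [discrim] at this
  rw [← Real.sqrt_mul hx]
  exact Real.le_sqrt_of_sq_le (by linarith)

lemma trace_mul_re (f : Lam d L → Lam d L → ℝ) (X γ : Matrix (Lam d L) (Lam d L) ℂ)
    (hX : ∀ x y, X x y = f x y) :
    ((X * γ).trace).re = ∑ x, ∑ y, f x y * (γ y x).re := by
  simp only [Matrix.trace, diag_apply, mul_apply, hX, Complex.re_sum, Complex.re_ofReal_mul]

lemma sum_hopEntry_mul (μ : ℝ) (G : Lam d L → Lam d L → ℝ) :
    ∑ x, ∑ y, hopEntry μ x y * G x y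
      = (2 * d - μ) * ∑ x, G x x - ∑ x, ∑ y, nnW x y * G x y := by
  simp only [hopEntry, sub_mul, ite_mul, zero_mul, Finset.sum_sub_distrib, Finset.sum_ite_eq,
    Finset.mem_univ, if_true, Finset.mul_sum]

lemma sum_nnW_boundary_le (hL : 3 ≤ L) (A B : Lam d L → Prop) (hAB : ∀ x, A x → ¬ B x)
    {r : Lam d L → ℝ} (hr : ∀ x, 0 ≤ r x) (x : Lam d L) :
    ∑ y, nnW x y * (if B x ∧ A y then r x else 0) ≤ if x ∈ bdry B then 2 * d * r x else 0 := by
  split_ifs with hx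
  · rw [← sum_nnW hL x, Finset.sum_mul]
    refine Finset.sum_le_sum fun y _ => mul_le_mul_of_nonneg_left ?_ (nnW_nonneg x y)
    split_ifs
    exacts [le_rfl, hr x]
  · refine (Finset.sum_eq_zero fun y _ => ?_).le
    rw [nnW, ite_mul, one_mul, zero_mul, ← ite_and, if_neg]
    rintro ⟨h1, h2, h3⟩
    exact hx (by simpa [bdry] using ⟨h2, y, h1, hAB y h3⟩)

/-- Decoupling of the region `A` from its complement, when the particles are expelled from `B` by a
potential of height `K` and have density at most `s ^ 2` outside `A` and `B`. -/
lemma decoupled_energy_le (hL : 3 ≤ L) (hd : 1 ≤ d) {μ α s K : ℝ} (hμ0 : 0 ≤ μ) (hμ : μ ≤ 1 / 2)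
    (hα : 0 < α) (hs : 12 * d * s ≤ α) (hK : 2 * μ ≤ K) (hKα : 24 * d ^ 2 ≤ K * α)
    (A B : Lam d L → Prop) (hAB : ∀ x, A x → ¬ B x) (G : Lam d L → Lam d L → ℝ)
    {r : Lam d L → ℝ} (hr : ∀ x, 0 ≤ r x) (hr1 : ∀ x, r x ≤ 1) (hG : ∀ x y, G x y ≤ r x * r y)
    (hGr : ∀ x, G x x = r x ^ 2) (hrs : ∀ x, ¬ A x → ¬ B x → r x ≤ s) :
    (∑ x, ∑ y, hopEntry μ x y * (if A x ∧ A y then G x y else 0))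
        - α / 3 * ((bdry B).card + (Finset.univ.filter fun x => ¬ A x ∧ ¬ B x).card)
      ≤ (∑ x, ∑ y, hopEntry μ x y * G x y) + K * ∑ x, if B x then r x ^ 2 else 0 := by
  have hd1 : (1 : ℝ) ≤ d := by exact_mod_cast hd
  have hs0 : ∀ x, ¬ A x → ¬ B x → 0 ≤ s := fun x ha hb => (hr x).trans (hrs x ha hb)
  set b : Lam d L → ℝ := fun x => if A x then 0 else if B x then r x ^ 2 / 2 else s with hb
  set h : Lam d L → Lam d L → ℝ := fun x y => if B x ∧ A y then r x else 0 with hh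
  have hpt : ∀ x y, nnW x y * G x y ≤ nnW x y * (if A x ∧ A y then G x y else 0)
      + nnW x y * b x + nnW x y * b y + nnW x y * h x y + nnW x y * h y x := by
    intro x y
    rw [← mul_add, ← mul_add, ← mul_add, ← mul_add]
    refine mul_le_mul_of_nonneg_left ?_ (nnW_nonneg x y)
    have g := hG x y
    have x0 := hr x
    have x1 := hr1 x
    have y0 := hr y
    have y1 := hr1 y
    have ax := hAB x
    have ay := hAB y
    have sx := hrs x
    have sy := hrs y
    have gx : r x * r y ≤ r x := by nlinarith
    have gy : r x * r y ≤ r y := by nlinarith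
    have gxy : r x * r y ≤ r x ^ 2 / 2 + r y ^ 2 / 2 := by nlinarith [sq_nonneg (r x - r y)]
    simp only [hb, hh]
    have qx := sq_nonneg (r x)
    have qy := sq_nonneg (r y)
    by_cases a1 : A x <;> by_cases a2 : A y <;> by_cases b1 : B x <;> by_cases b2 : B y <;>
      simp only [a1, a2, b1, b2, and_self, and_true, and_false, if_true, if_false,
        not_true, not_false_eq_true, forall_const, IsEmpty.forall_iff] at ax ay sx sy ⊢ <;>
      linarith
  have hsum := Finset.sum_le_sum fun x (_ : x ∈ Finset.univ) =>
    Finset.sum_le_sum fun y (_ : y ∈ Finset.univ) => hpt x y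
  have hcomm : ∑ x, ∑ y, nnW x y * h y x = ∑ x, ∑ y, nnW x y * h x y := by
    rw [Finset.sum_comm]
    simp_rw [nnW_comm]
  have hbd := Finset.sum_le_sum fun x (_ : x ∈ Finset.univ) =>
    sum_nnW_boundary_le hL A B hAB hr x
  simp_rw [Finset.sum_add_distrib, hcomm, sum_nnW_mul_left hL b, sum_nnW_mul_right hL b] at hsum
  rw [sum_hopEntry_mul, sum_hopEntry_mul]
  have hsite : ∀ x, 4 * d * b x + 2 * (if x ∈ bdry B then 2 * d * r x else 0)
      ≤ (2 * d - μ) * G x x - (2 * d - μ) * (if A x ∧ A x then G x x else 0)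
        + K * (if B x then r x ^ 2 else 0)
        + α / 3 * ((if x ∈ bdry B then 1 else 0) + (if ¬ A x ∧ ¬ B x then 1 else 0)) := by
    intro x
    have hbB : x ∈ bdry B → B x := fun hx => (Finset.mem_filter.mp hx).2.1
    have hq : 4 * d * r x ≤ (K - μ) * r x ^ 2 + α / 3 := by
      have h1 : 0 ≤ K * α := le_trans (by positivity) hKα
      have hK0 : 0 < K := by
        by_contra hcon
        have : K * α ≤ 0 := mul_nonpos_of_nonpos_of_nonneg (not_lt.mp hcon) hα.le
        nlinarith
      have h2 : K / 2 * r x ^ 2 ≤ (K - μ) * r x ^ 2 :=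
        mul_le_mul_of_nonneg_right (by linarith) (sq_nonneg _)
      have h3 : 0 ≤ K * (K / 2 * r x ^ 2 + α / 3 - 4 * d * r x) := by
        nlinarith [sq_nonneg (K * r x - 4 * d)]
      have h4 := nonneg_of_mul_nonneg_right h3 hK0
      linarith
    have hq' : 0 ≤ (K - μ) * r x ^ 2 := mul_nonneg (by linarith) (sq_nonneg _)
    have hq'' : 0 ≤ (2 * d - μ) * r x ^ 2 := mul_nonneg (by linarith) (sq_nonneg _)
    have ax := hAB x
    rw [hGr]
    simp only [hb]
    by_cases a : A x <;> by_cases bb : B x <;> by_cases c : x ∈ bdry B <;>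
      simp only [a, bb, c, and_self, if_true, if_false, not_true, not_false_eq_true, forall_const,
        imp_false, and_true, and_false] at hbB ax ⊢ <;>
      nlinarith
  have hsite' := Finset.sum_le_sum fun x (_ : x ∈ Finset.univ) => hsite x
  simp only [Finset.sum_add_distrib, Finset.sum_sub_distrib, ← Finset.mul_sum,
    Finset.sum_boole] at hsite'
  rw [Finset.filter_mem_eq_inter, Finset.univ_inter] at hsite'
  linarith

lemma IsDM.density_mem {γ : Matrix (Lam d L) (Lam d L) ℂ} (h : IsDM γ) (x : Lam d L) :
    0 ≤ (γ x x).re ∧ (γ x x).re ≤ 1 := by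
  refine ⟨(Complex.le_def.mp h.1.diag_nonneg).1, ?_⟩
  have := (Complex.le_def.mp (h.2.diag_nonneg (i := x))).1
  simpa using this

/-- The effective energy of one spin component. -/
lemma spin_energy_ge (hL : 3 ≤ L) (hd : 1 ≤ d) {μ α s K e : ℝ} (hμ0 : 0 ≤ μ) (hμ : μ ≤ 1 / 2)
    (hα : 0 < α) (hs0 : 0 ≤ s) (hs : 12 * d * s ≤ α) (hK : 2 * μ ≤ K) (hKα : 24 * d ^ 2 ≤ K * α)
    (he : seaDepth d L μ = e * (L : ℝ) ^ d) (hαe : α ≤ 9 / (2048 * (d : ℝ) ^ 3) * e)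
    (A B : Lam d L → Prop) (hAB : ∀ x, A x → ¬ B x) {γ : Matrix (Lam d L) (Lam d L) ℂ}
    (hγ : IsDM γ) (hrs : ∀ x, ¬ A x → ¬ B x → (γ x x).re ≤ s ^ 2) :
    α * (bdry A).card - e * (Finset.univ.filter A).card
        - α / 3 * ((bdry B).card + (Finset.univ.filter fun x => ¬ A x ∧ ¬ B x).card)
      ≤ ((hop d L μ * γ).trace).re + K * ∑ x, if B x then (γ x x).re else 0 := by
  have h1 := decoupled_energy_le hL hd hμ0 hμ hα hs hK hKα A B hAB (fun x y => (γ y x).re)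
    (r := fun x => √(γ x x).re) (fun x => Real.sqrt_nonneg _)
    (fun x => Real.sqrt_le_one.mpr (hγ.density_mem x).2)
    (fun x y => re_le_sqrt_mul_sqrt hγ.1 x y)
    (fun x => (Real.sq_sqrt (hγ.density_mem x).1).symm)
    (fun x ha hb => Real.sqrt_le_iff.mpr ⟨hs0, hrs x ha hb⟩)
  simp only [Real.sq_sqrt (hγ.density_mem _).1] at h1
  rw [← trace_mul_re _ _ γ (hop_apply μ)] at h1
  have h2 := negTrace_le_trace (hopOn_isHermitian A μ) hγ.1 hγ.2
  rw [trace_mul_re (fun x y => if A x ∧ A y then hopEntry μ x y else 0) _ γ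
    (fun x y => by rw [hopOn, of_apply, hop_apply]; split_ifs <;> simp)] at h2
  simp only [ite_mul, zero_mul] at h2
  simp only [mul_ite, mul_zero] at h1 h2
  have h3 := le_negTrace_hopOn hL hd A hμ0 hμ
  have hN : (0 : ℝ) < (L : ℝ) ^ d := by
    have : 0 < L := by omega
    positivity
  rw [he, mul_comm e, mul_assoc] at h3
  have h4 := le_of_mul_le_mul_left h3 hN
  have h5 := mul_le_mul_of_nonneg_right hαe (Nat.cast_nonneg (α := ℝ) (bdry A).card)
  linarith

/-- Ferromagnetic lower bound for the energy functional. -/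
lemma neg_seaDepth_le_hfzE (hL : 3 ≤ L) (hd : 1 ≤ d) {μ α δ U e : ℝ} (hμ0 : 0 ≤ μ)
    (hμ : μ ≤ 1 / 2) (hα : 0 < α) (hδ0 : 0 < δ) (hδ : δ ≤ α ^ 2 / (12 * (d : ℝ)) ^ 2)
    (hU : 2 * μ ≤ U * δ) (hUα : 24 * d ^ 2 ≤ U * δ * α)
    (he : seaDepth d L μ = e * (L : ℝ) ^ d) (hαe : α ≤ 9 / (2048 * (d : ℝ) ^ 3) * e)
    {γu γd : Matrix (Lam d L) (Lam d L) ℂ} (hu : IsDM γu) (hdn : IsDM γd) :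
    -seaDepth d L μ ≤ hfzE μ U γu γd := by
  have hd1 : (1 : ℝ) ≤ d := by exact_mod_cast hd
  obtain ⟨A, hA⟩ : ∃ A : Lam d L → Prop, ∀ x, A x ↔ δ ≤ (γu x x).re ∧ (γd x x).re ≤ (γu x x).re :=
    ⟨_, fun _ => Iff.rfl⟩
  obtain ⟨B, hB⟩ : ∃ B : Lam d L → Prop, ∀ x, B x ↔ δ ≤ (γd x x).re ∧ (γu x x).re < (γd x x).re :=
    ⟨_, fun _ => Iff.rfl⟩
  have hAB : ∀ x, A x → ¬ B x := fun x h1 h2 =>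
    absurd ((hB x).mp h2).2 (not_lt.mpr ((hA x).mp h1).2)
  have hs0 := Real.sqrt_nonneg δ
  have hs2 := Real.sq_sqrt hδ0.le
  have hs : 12 * d * √δ ≤ α := by
    have : √δ ≤ α / (12 * d) := by
      rw [Real.sqrt_le_iff]
      exact ⟨by positivity, by rwa [div_pow]⟩
    rw [le_div_iff₀ (by positivity)] at this
    linarith
  have hC : ∀ x, ¬ A x → ¬ B x → (γu x x).re ≤ δ ∧ (γd x x).re ≤ δ := by
    intro x ha hb
    simp only [hA, hB, not_and, not_le, not_lt] at ha hb
    by_contra! hcon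
    rcases le_or_gt δ (γu x x).re with h | h
    · have h1 := ha h
      have h2 := hb (h.trans h1.le)
      linarith
    · have h2 := hb (hcon h.le).le
      linarith [hcon h.le]
  have e1 := spin_energy_ge hL hd hμ0 hμ hα hs0 hs hU hUα he hαe A B hAB hu
    (fun x ha hb => by rw [hs2]; exact (hC x ha hb).1)
  have e2 := spin_energy_ge hL hd hμ0 hμ hα hs0 hs hU hUα he hαe B A
    (fun x hb ha => hAB x ha hb) hdn (fun x hb ha => by rw [hs2]; exact (hC x ha hb).2)
  have hU0 : 0 ≤ U := by
    by_contra hcon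
    have h1 : U * δ * α < 0 := by
      have := mul_neg_of_neg_of_pos (not_le.mp hcon) hδ0
      exact mul_neg_of_neg_of_pos this hα
    have h2 : (0 : ℝ) ≤ 24 * d ^ 2 := by positivity
    linarith
  have hint : U * δ * (∑ x, if B x then (γu x x).re else 0)
      + U * δ * (∑ x, if A x then (γd x x).re else 0)
      ≤ U * ∑ x, (γu x x).re * (γd x x).re := by
    rw [mul_assoc, mul_assoc, ← mul_add, Finset.mul_sum, Finset.mul_sum,
      ← Finset.sum_add_distrib]
    refine mul_le_mul_of_nonneg_left (Finset.sum_le_sum fun x _ => ?_) hU0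
    have u0 := (hu.density_mem x).1
    have d0 := (hdn.density_mem x).1
    by_cases ha : A x
    · have hb := hAB x ha
      simp only [ha, hb, if_true, if_false, mul_zero, zero_add]
      exact mul_le_mul_of_nonneg_right ((hA x).mp ha).1 d0
    · by_cases hb : B x
      · simp only [ha, hb, if_true, if_false, mul_zero, add_zero]
        rw [mul_comm]
        exact mul_le_mul_of_nonneg_left ((hB x).mp hb).1 u0
      · simp only [ha, hb, if_false, mul_zero, add_zero]
        positivity
  have hE : hfzE μ U γu γd = ((hop d L μ * γu).trace).re + ((hop d L μ * γd).trace).re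
      + U * ∑ x, (γu x x).re * (γd x x).re := by
    rw [hfzE, Matrix.mul_add, Matrix.trace_add, Complex.add_re]
    rfl
  have hcard : ((Finset.univ.filter A).card : ℝ) + (Finset.univ.filter B).card
      + (Finset.univ.filter fun x => ¬ A x ∧ ¬ B x).card = (L : ℝ) ^ d := by
    have h1 : (L : ℝ) ^ d = ∑ _x : Lam d L, (1 : ℝ) := by
      simp [Finset.card_univ, ZMod.card]
    rw [h1, ← Finset.sum_boole, ← Finset.sum_boole, ← Finset.sum_boole,
      ← Finset.sum_add_distrib, ← Finset.sum_add_distrib]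
    refine Finset.sum_congr rfl fun x _ => ?_
    have := hAB x
    by_cases ha : A x <;> by_cases hb : B x <;> simp only [ha, hb, forall_const, not_true,
      not_false_eq_true, and_true, and_false, if_true, if_false, add_zero, zero_add] at this ⊢
  have hcomm : (Finset.univ.filter fun x => ¬ B x ∧ ¬ A x)
      = Finset.univ.filter fun x => ¬ A x ∧ ¬ B x := by
    simp only [and_comm]
  rw [hcomm] at e2
  have he0 : 2 / 3 * α ≤ e := by
    have h9 : 9 / (2048 * (d : ℝ) ^ 3) ≤ 1 := by
      rw [div_le_one (by positivity)]
      have : (1 : ℝ) ≤ (d : ℝ) ^ 3 := one_le_pow₀ hd1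
      linarith
    have h8 : (0 : ℝ) < 9 / (2048 * (d : ℝ) ^ 3) := by positivity
    have : 0 < e := (mul_pos_iff_of_pos_left h8).mp (hα.trans_le hαe)
    nlinarith
  have hc := mul_le_mul_of_nonneg_right he0
    (Nat.cast_nonneg (α := ℝ) (Finset.univ.filter fun x => ¬ A x ∧ ¬ B x).card)
  have hbA : 0 ≤ α * ((bdry A).card : ℝ) := by positivity
  have hbB : 0 ≤ α * ((bdry B).card : ℝ) := by positivity
  rw [hE, he, ← hcard]
  linarith

end Spins

section Constants

lemma sum_sq_sub (N : ℕ) (c : ℝ) :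
    ∑ j : Fin N, ((j : ℝ) - c) ^ 2
      = N * (N - 1) * (2 * N - 1) / 6 - c * N * (N - 1) + c ^ 2 * N := by
  induction N with
  | zero => simp
  | succ N ih =>
    rw [Fin.sum_univ_castSucc]
    simp only [Fin.val_castSucc, Fin.val_last, ih]
    push_cast
    ring

lemma sum_pi_apply {d N : ℕ} (g : Fin N → ℝ) (ν : Fin d) :
    ∑ f : Fin d → Fin N, g (f ν) = (N : ℝ) ^ (d - 1) * ∑ j, g j := by
  have h := Finset.prod_univ_sum (fun _ : Fin d => (Finset.univ : Finset (Fin N)))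
    (fun i j => if i = ν then g j else 1)
  rw [Fintype.piFinset_univ, ← Finset.mul_prod_erase _ _ (Finset.mem_univ ν)] at h
  have h1 : ∏ i ∈ Finset.univ.erase ν, ∑ j : Fin N, (if i = ν then g j else 1)
      = (N : ℝ) ^ (d - 1) := by
    rw [Finset.prod_congr rfl (g := fun _ => (N : ℝ)), Finset.prod_const,
      Finset.card_erase_of_mem (Finset.mem_univ ν), Finset.card_univ, Fintype.card_fin]
    intro i hi
    simp [Finset.ne_of_mem_erase hi]
  rw [h1] at h
  simp only [if_true, Finset.prod_ite_eq', Finset.mem_univ] at h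
  rw [← h, mul_comm]

lemma sqrt_one_add_two_div_pow_le (d : ℕ) (hd : 1 ≤ d) :
    √(1 + 2 / (d : ℝ)) ^ d ≤ Real.exp 1 := by
  have hd1 : (0 : ℝ) < d := by exact_mod_cast hd
  have h1 : √(1 + 2 / (d : ℝ)) ≤ Real.exp (1 / d) := by
    refine le_trans ?_ (Real.add_one_le_exp _)
    rw [Real.sqrt_le_iff]
    refine ⟨by positivity, ?_⟩
    have : (0 : ℝ) ≤ (1 / d) ^ 2 := by positivity
    have e : (2 : ℝ) / d = 2 * (1 / d) := by ring
    rw [e]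
    linarith
  calc √(1 + 2 / (d : ℝ)) ^ d ≤ Real.exp (1 / d) ^ d := pow_le_pow_left₀ (Real.sqrt_nonneg _) h1 d
    _ = Real.exp 1 := by rw [← Real.exp_nat_mul]; congr 1; field_simp

lemma sqrt_pow_le_sq_mul_Gamma (d : ℕ) (hd : 1 ≤ d) :
    √(Real.pi * d / 18) ^ d ≤ (d : ℝ) ^ 2 * Real.Gamma (d / 2) := by
  induction d using Nat.strong_induction_on with
  | _ d ih =>
    rcases (by omega : d = 1 ∨ d = 2 ∨ 3 ≤ d) with rfl | rfl | h3
    · simp only [Nat.cast_one, mul_one, pow_one, one_pow, one_mul]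
      rw [Real.Gamma_one_half_eq]
      exact Real.sqrt_le_sqrt (by linarith [Real.pi_pos])
    · have := Real.pi_pos
      rw [Real.sq_sqrt (by positivity)]
      norm_num
      linarith [Real.pi_lt_d2]
    · obtain ⟨e, rfl⟩ : ∃ e, d = e + 2 := ⟨d - 2, by omega⟩
      have he : 1 ≤ e := by omega
      have he1 : (1 : ℝ) ≤ e := by exact_mod_cast he
      have hpi := Real.pi_pos
      have hI := ih e (by omega) he
      have hG : Real.Gamma (((e + 2 : ℕ) : ℝ) / 2) = e / 2 * Real.Gamma (e / 2) := by
        rw [← Real.Gamma_add_one (by positivity)]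
        congr 1
        push_cast
        ring
      have hG0 : 0 < Real.Gamma ((e : ℝ) / 2) := Real.Gamma_pos_of_pos (by positivity)
      have hs : √(Real.pi * ((e + 2 : ℕ) : ℝ) / 18) = √(Real.pi * e / 18) * √(1 + 2 / (e : ℝ)) := by
        rw [← Real.sqrt_mul (by positivity)]
        congr 1
        push_cast
        field_simp
      have hp2 : √(Real.pi * ((e + 2 : ℕ) : ℝ) / 18) ^ 2 = Real.pi * (e + 2) / 18 := by
        rw [Real.sq_sqrt (by positivity)]
        push_cast
        rfl
      rw [pow_add, hp2, hG, hs, mul_pow]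
      have hE := sqrt_one_add_two_div_pow_le e he
      have hpe : Real.pi * Real.exp 1 ≤ 9 := by
        have h1 := Real.exp_one_lt_d9
        have h2 := Real.pi_lt_d2
        have h3 := Real.exp_pos 1
        nlinarith
      push_cast
      calc √(Real.pi * e / 18) ^ e * √(1 + 2 / (e : ℝ)) ^ e * (Real.pi * (e + 2) / 18)
          ≤ (e : ℝ) ^ 2 * Real.Gamma (e / 2) * Real.exp 1 * (Real.pi * (e + 2) / 18) := by
            gcongr
        _ = (Real.pi * Real.exp 1) * ((e : ℝ) ^ 2 * Real.Gamma (e / 2) * (e + 2) / 18) := by ring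
        _ ≤ 9 * ((e : ℝ) ^ 2 * Real.Gamma (e / 2) * (e + 2) / 18) := by gcongr
        _ = (e * (e + 2)) * (e / 2 * Real.Gamma (e / 2)) := by ring
        _ ≤ (e + 2) ^ 2 * (e / 2 * Real.Gamma (e / 2)) := by
            gcongr
            nlinarith

end Constants

section FermiSea

variable {d L : ℕ} [NeZero L]

lemma two_sub_re_stdAddChar_le (j : ℤ) :
    2 - 2 * (ZMod.stdAddChar (j : ZMod L) : ℂ).re ≤ (2 * Real.pi / L) ^ 2 * (j : ℝ) ^ 2 := by
  have h : (ZMod.stdAddChar (j : ZMod L) : ℂ)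
      = Complex.exp ((2 * Real.pi / L * j : ℝ) * Complex.I) := by
    rw [ZMod.stdAddChar_coe]
    congr 1
    push_cast
    ring
  rw [h, Complex.exp_ofReal_mul_I_re, ← mul_pow]
  linarith [Real.one_sub_sq_div_two_le_cos (x := 2 * Real.pi / L * j)]

lemma le_seaDepth (hd : 1 ≤ d) (μ : ℝ) {m : ℕ} (hm : 2 * m + 1 ≤ L) :
    (2 * m + 1 : ℝ) ^ d * (μ - d * (2 * Real.pi / L) ^ 2 * (m * (m + 1) / 3)) ≤ seaDepth d L μ := by
  set N := 2 * m + 1 with hN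
  let φ : (Fin d → Fin N) → Lam d L := fun f ν => (((f ν : ℕ) - (m : ℤ) : ℤ) : ZMod L)
  have hφ : Function.Injective φ := by
    intro f g h
    ext ν
    have := congrFun h ν
    simp only [φ, Int.cast_sub, Int.cast_natCast, sub_left_inj] at this
    rw [ZMod.natCast_eq_natCast_iff'] at this
    rwa [Nat.mod_eq_of_lt (by omega), Nat.mod_eq_of_lt (by omega)] at this
  have h1 : ∑ f, depth μ (φ f) ≤ seaDepth d L μ := by
    rw [seaDepth, ← Finset.sum_image (s := Finset.univ) (g := φ) (f := depth μ) hφ.injOn]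
    exact Finset.sum_le_sum_of_subset_of_nonneg (Finset.subset_univ _)
      fun _ _ _ => le_max_right _ _
  refine le_trans ?_ h1
  have h2 : ∀ f : Fin d → Fin N,
      μ - ∑ ν, (2 * Real.pi / L) ^ 2 * ((f ν : ℝ) - m) ^ 2 ≤ depth μ (φ f) := by
    intro f
    refine le_trans (sub_le_sub_left ?_ μ) (le_max_left _ _)
    rw [disp]
    refine Finset.sum_le_sum fun ν _ => ?_
    have := two_sub_re_stdAddChar_le (L := L) ((f ν : ℕ) - (m : ℤ))
    push_cast at this ⊢
    simpa [φ] using this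
  refine le_trans ?_ (Finset.sum_le_sum fun f _ => h2 f)
  rw [Finset.sum_sub_distrib, Finset.sum_comm]
  simp_rw [sum_pi_apply (fun j : Fin N => (2 * Real.pi / L) ^ 2 * ((j : ℝ) - m) ^ 2),
    ← Finset.mul_sum, sum_sq_sub]
  obtain ⟨e, rfl⟩ : ∃ e, d = e + 1 := ⟨d - 1, by omega⟩
  simp only [Finset.sum_const, Finset.card_univ, Fintype.card_pi, Fintype.card_fin,
    Finset.prod_const, nsmul_eq_mul, hN, Nat.add_sub_cancel]
  push_cast
  apply le_of_eq
  ring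

lemma le_seaDepth_div (hd : 1 ≤ d) {μ : ℝ} (hμ0 : 0 < μ) (hμ : μ ≤ 1 / 2)
    (hL : 24 * (4 * (d : ℝ)) ^ 2 / μ ^ 2 ≤ L) :
    199 / 200 * (μ / 4) * (3 / (2 * Real.pi) * √(μ / d)) ^ d ≤ seaDepth d L μ / (L : ℝ) ^ d := by
  have hd1 : (1 : ℝ) ≤ d := by exact_mod_cast hd
  have hpi := Real.pi_pos
  have hpi3 := Real.pi_gt_three
  have hL' : 384 * (d : ℝ) ^ 2 ≤ L * μ ^ 2 := by
    rw [div_le_iff₀ (by positivity)] at hL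
    linarith
  have hL0 : (0 : ℝ) < L := by
    by_contra hcon
    have h1 : (L : ℝ) * μ ^ 2 ≤ 0 := mul_nonpos_of_nonpos_of_nonneg (not_lt.mp hcon) (sq_nonneg _)
    nlinarith
  set q : ℝ := 3 / (2 * Real.pi) * √(μ / d) with hq
  have hq0 : 0 < q := by positivity
  have hq2 : q ^ 2 = 9 * μ / (4 * Real.pi ^ 2 * d) := by
    rw [hq, mul_pow, Real.sq_sqrt (by positivity), div_pow]
    field_simp
    norm_num
  have hq1 : q ≤ 1 := by
    have h1 : q ^ 2 ≤ 1 := by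
      rw [hq2, div_le_one (by positivity)]
      nlinarith
    nlinarith
  have hX : 400 * d ≤ L * q := by
    have h1 : (400 * (d : ℝ)) ^ 2 ≤ (L * q) ^ 2 := by
      rw [mul_pow (L : ℝ), hq2, mul_div_assoc', le_div_iff₀ (by positivity)]
      have h2 : (384 * (d : ℝ) ^ 2) ^ 2 ≤ (L * μ ^ 2) ^ 2 := by gcongr
      have h3 : (L * μ ^ 2) ^ 2 ≤ (L : ℝ) ^ 2 * μ * (1 / 8) := by
        have h5 : μ ^ 3 ≤ (1 / 2) ^ 3 := by gcongr
        calc (L * μ ^ 2) ^ 2 = (L : ℝ) ^ 2 * μ * μ ^ 3 := by ring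
          _ ≤ (L : ℝ) ^ 2 * μ * (1 / 2) ^ 3 := by gcongr
          _ = _ := by norm_num
      have h4 : Real.pi ^ 2 ≤ 10 := by nlinarith [Real.pi_lt_d2]
      have h6 : (d : ℝ) ^ 3 ≤ (d : ℝ) ^ 4 := pow_le_pow_right₀ hd1 (by norm_num)
      have h7 : (d : ℝ) ^ 3 * Real.pi ^ 2 ≤ (d : ℝ) ^ 4 * 10 := by gcongr
      nlinarith
    exact le_of_sq_le_sq h1 (by positivity)
  set m := ⌊(L * q - 1) / 2⌋₊ with hm
  have hm1 : (m : ℝ) ≤ (L * q - 1) / 2 := Nat.floor_le (by linarith)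
  have hm2 : (L * q - 1) / 2 < m + 1 := Nat.lt_floor_add_one _
  have hmL : 2 * m + 1 ≤ L := by
    have : (2 * m + 1 : ℝ) ≤ L := by nlinarith
    exact_mod_cast this
  have h1 := le_seaDepth hd μ hmL
  have hc : μ / 4 ≤ μ - d * (2 * Real.pi / L) ^ 2 * (m * (m + 1) / 3) := by
    have h2 : (m : ℝ) * (m + 1) ≤ (L * q) ^ 2 / 4 := by nlinarith
    have h3 : d * (2 * Real.pi / L) ^ 2 * (m * (m + 1) / 3)
        ≤ d * (2 * Real.pi / L) ^ 2 * ((L * q) ^ 2 / 4 / 3) := by gcongr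
    have h4 : d * (2 * Real.pi / L) ^ 2 * ((L * q) ^ 2 / 4 / 3) = 3 * μ / 4 := by
      rw [mul_pow, hq2]
      field_simp
      norm_num
    linarith
  rw [le_div_iff₀ (by positivity)]
  refine le_trans ?_ h1
  have hXpos : 0 < L * q := by positivity
  have hB : 199 / 200 ≤ (1 - 2 / (L * q)) ^ d := by
    have h2 : 2 / (L * q) ≤ 1 / (200 * d) := by
      rw [div_le_div_iff₀ hXpos (by positivity)]
      linarith
    have h3 : (1 : ℝ) / (200 * d) ≤ 1 := by
      rw [div_le_one (by positivity)]
      linarith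
    have h4 := one_add_mul_le_pow (a := -(2 / (L * q))) (by linarith) d
    have h5 : d * (2 / (L * q)) ≤ d * (1 / (200 * d)) := by gcongr
    have h6 : d * (1 / (200 * (d : ℝ))) = 1 / 200 := by field_simp
    rw [← sub_eq_add_neg] at h4
    linarith
  have hA : (L * q) ^ d * (199 / 200) ≤ (2 * m + 1 : ℝ) ^ d := by
    calc (L * q) ^ d * (199 / 200) ≤ (L * q) ^ d * (1 - 2 / (L * q)) ^ d := by gcongr
      _ = (L * q - 2) ^ d := by
        rw [← mul_pow]
        congr 1
        field_simp
      _ ≤ (2 * m + 1 : ℝ) ^ d := by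
        refine pow_le_pow_left₀ (by linarith) (by linarith) d
  calc 199 / 200 * (μ / 4) * q ^ d * (L : ℝ) ^ d = (L * q) ^ d * (199 / 200) * (μ / 4) := by
        rw [mul_pow]
        ring
    _ ≤ (2 * m + 1 : ℝ) ^ d * (μ - d * (2 * Real.pi / L) ^ 2 * (m * (m + 1) / 3)) :=
        mul_le_mul hA hc (by positivity) (by positivity)

lemma alphaStar_eq (hd : 1 ≤ d) {μ : ℝ} (hμ0 : 0 < μ) :
    alphaStar d μ = μ / (1024 * (d : ℝ) ^ 2 * d ^ 3 * Real.Gamma (d / 2))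
      * (√Real.pi * √μ / (√2 * (2 * Real.pi))) ^ d := by
  have hd1 : (1 : ℝ) ≤ d := by exact_mod_cast hd
  have hG : 0 < Real.Gamma ((d : ℝ) / 2) := Real.Gamma_pos_of_pos (by positivity)
  have hr : ∀ x : ℝ, 0 < x → x ^ ((d : ℝ) / 2) = √x ^ d := by
    intro x hx
    rw [Real.sqrt_eq_rpow, ← Real.rpow_natCast, ← Real.rpow_mul hx.le]
    congr 1
    ring
  have e1 : (2 + (d : ℝ)) / 2 = 1 + d / 2 := by ring
  rw [alphaStar, sphereMeasure, e1, Real.rpow_add hμ0, Real.rpow_add two_pos, Real.rpow_one,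
    Real.rpow_one, hr _ Real.pi_pos, hr _ hμ0, hr _ two_pos, div_pow, mul_pow, mul_pow _ _ d]
  have := Real.pi_pos
  field_simp
  ring

lemma alphaStar_pos (hd : 1 ≤ d) {μ : ℝ} (hμ0 : 0 < μ) : 0 < alphaStar d μ := by
  have hd1 : (1 : ℝ) ≤ d := by exact_mod_cast hd
  have hG : 0 < Real.Gamma ((d : ℝ) / 2) := Real.Gamma_pos_of_pos (by positivity)
  have := Real.pi_pos
  rw [alphaStar_eq hd hμ0]
  positivity

lemma alphaStar_le (hd : 1 ≤ d) {μ : ℝ} (hμ0 : 0 < μ) (hμ : μ ≤ 1 / 2)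
    (hL : 24 * (4 * (d : ℝ)) ^ 2 / μ ^ 2 ≤ L) :
    alphaStar d μ ≤ 9 / (2048 * (d : ℝ) ^ 3) * (seaDepth d L μ / (L : ℝ) ^ d) := by
  have hd1 : (1 : ℝ) ≤ d := by exact_mod_cast hd
  have hpi := Real.pi_pos
  have hG : 0 < Real.Gamma ((d : ℝ) / 2) := Real.Gamma_pos_of_pos (by positivity)
  refine le_trans ?_ (mul_le_mul_of_nonneg_left (le_seaDepth_div hd hμ0 hμ hL) (by positivity))
  have e : √Real.pi * √μ / (√2 * (2 * Real.pi))
      = 3 / (2 * Real.pi) * √(μ / d) * √(Real.pi * d / 18) := by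
    have h18 : (18 : ℝ) = 3 ^ 2 * 2 := by norm_num
    rw [Real.sqrt_div hμ0.le, Real.sqrt_div (by positivity), Real.sqrt_mul hpi.le, h18,
      Real.sqrt_mul (by norm_num), Real.sqrt_sq (by norm_num)]
    field_simp
  rw [alphaStar_eq hd hμ0, e, mul_pow _ _ d]
  have hg := sqrt_pow_le_sq_mul_Gamma d hd
  set Q := (3 / (2 * Real.pi) * √(μ / d)) ^ d
  have hQ : 0 ≤ Q := by positivity
  calc μ / (1024 * (d : ℝ) ^ 2 * d ^ 3 * Real.Gamma (d / 2)) * (Q * √(Real.pi * d / 18) ^ d)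
      ≤ μ / (1024 * (d : ℝ) ^ 2 * d ^ 3 * Real.Gamma (d / 2))
          * (Q * ((d : ℝ) ^ 2 * Real.Gamma (d / 2))) := by gcongr
    _ = μ * Q / d ^ 3 * (1 / 1024) := by field_simp
    _ ≤ μ * Q / d ^ 3 * (9 / 2048 * (199 / 200) / 4) :=
        mul_le_mul_of_nonneg_left (by norm_num) (by positivity)
    _ = _ := by field_simp

omit [NeZero L] in
lemma deltaStar_pos (hd : 1 ≤ d) {μ α : ℝ} (hμ0 : 0 < μ) (hμ : μ ≤ 1 / 2) (hα : 0 < α) :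
    0 < deltaStar d μ α := by
  have hd1 : (1 : ℝ) ≤ d := by exact_mod_cast hd
  have hlog : 0 ≤ Real.log (4 * d / μ) :=
    Real.log_nonneg (by rw [le_div_iff₀ hμ0]; linarith)
  have hlog2 : 0 < Real.log 2 := Real.log_pos one_lt_two
  rw [deltaStar, Mstar, kappaConst]
  refine lt_min (by positivity) (lt_min (by positivity) ?_)
  positivity

end FermiSea

/-- Theorem 1.2: explicit constants. For `0 < μ ≤ 1/2`, `d ≥ 1`,
every even `L ≥ L_*(μ) = 24(4d)²μ⁻²` and every `U ≥ U_*(μ, α_*(μ))`, the HFz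
ground-state energy equals `Tr{[-Δ - μ·Id]_-}`. -/
theorem hfz_ferromagnetism_explicit (d : ℕ) (hd : 1 ≤ d) (μ : ℝ)
    (hμ0 : 0 < μ) (hμhalf : μ ≤ 1 / 2)
    (L : ℕ) [NeZero L] (hLeven : Even L)
    (hL : 24 * (4 * (d : ℝ)) ^ 2 / μ ^ 2 ≤ L)
    (U : ℝ) (hU : Ustar d μ (alphaStar d μ) ≤ U) :
    IsLeast (hfzEnergies d L μ U) (negTrace (-(lap d L) - (μ : ℂ) • 1)) := by
  have hd1 : (1 : ℝ) ≤ d := by exact_mod_cast hd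
  have hL3 : 3 ≤ L := by
    rw [div_le_iff₀ (by positivity)] at hL
    have h1 : μ ^ 2 ≤ 1 := pow_le_one₀ hμ0.le (by linarith)
    have h2 : (L : ℝ) * μ ^ 2 ≤ L := mul_le_of_le_one_right (Nat.cast_nonneg L) h1
    have : (3 : ℝ) ≤ L := by nlinarith
    exact_mod_cast this
  have hN : (0 : ℝ) < (L : ℝ) ^ d := by
    have : 0 < L := by omega
    positivity
  have hα := alphaStar_pos hd hμ0
  have hδ := deltaStar_pos hd hμ0 hμhalf hα
  have hU1 := (le_max_left _ _).trans hU
  have hU2 := (le_max_right _ _).trans hU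
  rw [div_le_iff₀ hδ] at hU1
  rw [div_le_iff₀ (mul_pos hα hδ), mul_comm (alphaStar d μ), ← mul_assoc] at hU2
  have hX := hop_isHermitian (d := d) (L := L) μ
  constructor
  · refine ⟨negProj hX, 0, ⟨negProj_posSemidef hX, one_sub_negProj_posSemidef hX⟩,
      ⟨PosSemidef.zero, by rw [sub_zero]; exact PosSemidef.one⟩, ?_⟩
    rw [hfzE, add_zero]
    simp only [Matrix.zero_apply, Complex.zero_re, mul_zero, Finset.sum_const_zero, add_zero]
    exact trace_mul_negProj hX
  · rintro _ ⟨γu, γd, hu, hdn, rfl⟩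
    exact (negTrace_hop_le hL3 μ).trans (neg_seaDepth_le_hfzE hL3 hd hμ0.le hμhalf hα hδ
      (min_le_left _ _) hU1 hU2 (div_mul_cancel₀ _ hN.ne').symm
      (alphaStar_le hd hμ0 hμhalf hL) hu hdn)
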